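/- Let M be a smooth minimal hypersurface of R^{n+1} with n ≥ 3. Then for every φ ∈ C^1_c(M): ((n−2)²/4)∫_M φ²/|x|² dV ≤ ∫_M |∇_T φ|² dV, i.e., Carron's Hardy inequality with the sharp Euclidean constant holds on minimal hypersurfaces. -/

import Mathlib

open MeasureTheory
open scoped RealInnerProductSpace

noncomputable section

/-- Ambient Euclidean space `ℝ^{n+1}`. -/
abbrev Eu (n : ℕ) := EuclideanSpace ℝ (Fin (n + 1))

/-- A smooth `n`-dimensional hypersurface of `ℝ^{n+1}`, described by its carrier set
together with a smooth unit normal field; locally it is a regular level set of a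
smooth function. -/
structure Hypersurface (n : ℕ) where
  carrier : Set (Eu n)
  nu : Eu n → Eu n
  smooth_nu : ContDiff ℝ (⊤ : ℕ∞) nu
  unit_nu : ∀ x ∈ carrier, ‖nu x‖ = 1
  locally_level_set : ∀ x ∈ carrier, ∃ U : Set (Eu n), IsOpen U ∧ x ∈ U ∧
    ∃ f : Eu n → ℝ, ContDiff ℝ (⊤ : ℕ∞) f ∧
      carrier ∩ U = {y ∈ U | f y = 0} ∧
      (∀ y ∈ U, gradient f y ≠ 0) ∧
      (∀ y ∈ carrier ∩ U, nu y = ‖gradient f y‖⁻¹ • gradient f y)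

variable {n : ℕ}

/-- The `i`-th tangential derivative `δ_i φ = ∂_i φ − ν^i ∑_j (∂_j φ) ν^j`. -/
def tderiv (ν : Eu n → Eu n) (i : Fin (n + 1)) (φ : Eu n → ℝ) (x : Eu n) : ℝ :=
  fderiv ℝ φ x (EuclideanSpace.single i 1)
    - ν x i * ∑ j, fderiv ℝ φ x (EuclideanSpace.single j 1) * ν x j

/-- The tangential gradient `∇_T φ = ∇φ − (∇φ·ν)ν`. -/
def tgrad (ν : Eu n → Eu n) (φ : Eu n → ℝ) (x : Eu n) : Eu n :=
  gradient φ x - ⟪gradient φ x, ν x⟫ • ν x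

/-- The tangential divergence `div_T Z = ∑ i δ_i Z^i`. -/
def tdiv (ν : Eu n → Eu n) (Z : Eu n → Eu n) (x : Eu n) : ℝ :=
  ∑ i, tderiv ν i (fun y => Z y i) x

/-- The mean curvature `H = div_T ν` (sum of the principal curvatures). -/
def meanCurv (M : Hypersurface n) (x : Eu n) : ℝ := tdiv M.nu M.nu x

/-- The Laplace–Beltrami operator `Δφ = div_T (∇_T φ)`. -/
def lapBel (ν : Eu n → Eu n) (φ : Eu n → ℝ) (x : Eu n) : ℝ := tdiv ν (tgrad ν φ) x

/-- The surface measure on `M`: the `n`-dimensional Hausdorff measure restricted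
to the carrier of `M`. -/
def surfMeasure (M : Hypersurface n) : Measure (Eu n) :=
  (μH[(n : ℝ)]).restrict M.carrier

/-- `C^1` functions with compact support in a set `S`: ambient `C^1` functions
vanishing on `S` outside a compact subset `K ⊆ S`. -/
def C1cOn (S : Set (Eu n)) (φ : Eu n → ℝ) : Prop :=
  ContDiff ℝ 1 φ ∧ ∃ K : Set (Eu n), IsCompact K ∧ K ⊆ S ∧ ∀ x ∈ S, x ∉ K → φ x = 0

set_option linter.all false

/-- graph patch -/
structure Patch (M : Hypersurface n) (e : Eu n) where
  ι : EuclideanSpace ℝ (Fin n) →ₗᵢ[ℝ] Eu n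
  P : Eu n →L[ℝ] EuclideanSpace ℝ (Fin n)
  ι_P : ∀ x, ι (P x) = x - ⟪e, x⟫ • e
  P_ι : ∀ v, P (ι v) = v
  e_ι : ∀ v, ⟪e, ι v⟫ = 0
  O : Set (EuclideanSpace ℝ (Fin n))
  W : Set (Eu n)
  O_open : IsOpen O
  W_open : IsOpen W
  closedW : ∃ C, IsClosed C ∧ M.carrier ∩ W = C ∩ W
  Γ : EuclideanSpace ℝ (Fin n) → Eu n
  smooth : ContDiffOn ℝ 1 Γ O
  Γ_mem : ∀ u ∈ O, Γ u ∈ M.carrier ∩ W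
  P_Γ : ∀ u ∈ O, P (Γ u) = u
  P_mem : ∀ x ∈ M.carrier ∩ W, P x ∈ O
  Γ_P : ∀ x ∈ M.carrier ∩ W, Γ (P x) = x
  pos : ∀ x ∈ M.carrier ∩ W, 0 < ⟪M.nu x, e⟫
  tang : ∀ u ∈ O, ∀ v, ⟪M.nu (Γ u), fderiv ℝ Γ u v⟫ = 0

theorem exists_frame (e : Eu n) (he : ‖e‖ = 1) :
    ∃ (ι : EuclideanSpace ℝ (Fin n) →ₗᵢ[ℝ] Eu n) (P : Eu n →L[ℝ] EuclideanSpace ℝ (Fin n)),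
      (∀ x, ι (P x) = x - ⟪e, x⟫ • e) ∧ (∀ v, P (ι v) = v) ∧ (∀ v, ⟪e, ι v⟫ = 0) := by
  have hfr : Fact (Module.finrank ℝ (Eu n) = n + 1) := ⟨by simp⟩
  have he0 : e ≠ 0 := by rintro rfl; simp at he
  let R := (OrthonormalBasis.fromOrthogonalSpanSingleton (𝕜 := ℝ) n he0).repr
  let K := (ℝ ∙ e)ᗮ
  refine ⟨K.subtypeₗᵢ.comp R.symm.toLinearIsometry,
    (R.toContinuousLinearEquiv : K →L[ℝ] EuclideanSpace ℝ (Fin n)).comp K.orthogonalProjectionOnto, ?_, ?_, ?_⟩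
  · intro x
    have : ((K.orthogonalProjectionOnto x : K) : Eu n) = x - ⟪e, x⟫ • e := by
      have := Submodule.starProjection_orthogonal_val (K := (ℝ ∙ e)) x
      rw [Submodule.starProjection_unit_singleton ℝ he] at this
      exact this
    simpa using this
  · intro v
    simp
  · intro v
    have := (R.symm v).2
    rw [Submodule.mem_orthogonal_singleton_iff_inner_right] at this
    simpa using this

theorem exists_patch (M : Hypersurface n) (e : Eu n) (he : ‖e‖ = 1) (p : Eu n)
    (hp : p ∈ M.carrier) (hpe : 0 < ⟪M.nu p, e⟫) : ∃ Q : Patch M e, p ∈ Q.W := by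
  obtain ⟨ι, P, hιP, hPι, heι⟩ := exists_frame e he
  obtain ⟨U, hU, hpU, f, hf, hMU, hgrad, hnu⟩ := M.locally_level_set p hp
  have hee : ⟪e, e⟫ = (1:ℝ) := by rw [real_inner_self_eq_norm_sq, he]; norm_num
  have hPe : P e = 0 := by
    apply ι.injective
    rw [hιP, hee]; simp
  have hnuf : ∀ x ∈ M.carrier ∩ U, ∀ w, ⟪M.nu x, w⟫ = ‖gradient f x‖⁻¹ * fderiv ℝ f x w := by
    intro x hx w
    rw [hnu x hx, real_inner_smul_left, gradient, InnerProductSpace.toDual_symm_apply]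
  have hDe : ∀ x ∈ M.carrier ∩ U, 0 < ⟪M.nu x, e⟫ → fderiv ℝ f x e ≠ 0 := by
    intro x hx h h0
    rw [hnuf x hx, h0] at h; simp at h
  let F : Eu n → Eu n := fun x => x + (f x - ⟪e, x⟫) • e
  have hfd : Differentiable ℝ f := hf.differentiable (by simp)
  have hF : ContDiff ℝ (⊤ : ℕ∞) F := by exact contDiff_id.add ((hf.sub (contDiff_const.inner ℝ contDiff_id)).smul contDiff_const)
  have hF' : ∀ x, fderiv ℝ f x e ≠ 0 → ∃ L : Eu n ≃L[ℝ] Eu n,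
      HasFDerivAt F (L : Eu n →L[ℝ] Eu n) x := by
    intro x hx
    let L1 : Eu n →L[ℝ] Eu n :=
      ContinuousLinearMap.id ℝ _ + (fderiv ℝ f x - innerSL ℝ e).smulRight e
    let L2 : Eu n →L[ℝ] Eu n :=
      ContinuousLinearMap.id ℝ _ + ((fderiv ℝ f x e)⁻¹ • (innerSL ℝ e - fderiv ℝ f x)).smulRight e
    refine ⟨ContinuousLinearEquiv.equivOfInverse L1 L2 ?_ ?_, ?_⟩
    · intro w
      simp only [L1, L2, add_apply, ContinuousLinearMap.id_apply,
        ContinuousLinearMap.smulRight_apply, sub_apply, innerSL_apply_apply,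
        smul_apply, map_add, map_smul, hee,
        smul_eq_mul]
      match_scalars
      · ring
      · field_simp
        ring
    · intro w
      simp only [L1, L2, add_apply, ContinuousLinearMap.id_apply,
        ContinuousLinearMap.smulRight_apply, sub_apply, innerSL_apply_apply,
        smul_apply, map_add, map_smul, hee,
        smul_eq_mul]
      match_scalars
      · ring
      · field_simp
        ring
    · have h1 : HasFDerivAt (fun x => f x - ⟪e, x⟫) (fderiv ℝ f x - innerSL ℝ e) x :=
        (hfd x).hasFDerivAt.sub (innerSL ℝ e).hasFDerivAt
      exact (hasFDerivAt_id x).add (h1.smul_const e)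
  have heF : ∀ x, ⟪e, F x⟫ = f x := by
    intro x
    simp only [F, inner_add_right, inner_smul_right, hee]; ring
  have hPF : ∀ x, P (F x) = P x := by
    intro x
    simp only [F, map_add, map_smul, hPe]; simp
  obtain ⟨L, hL⟩ := hF' p (hDe p ⟨hp, hpU⟩ hpe)
  let Φ := hF.contDiffAt.toOpenPartialHomeomorph F hL (by simp)
  have hΦ : ∀ x, Φ x = F x := fun x => rfl
  have hcn : Continuous fun x => ⟪M.nu x, e⟫ := by
    have := M.smooth_nu.continuous
    fun_prop
  let G : Set (Eu n) := U ∩ {x | 0 < ⟪M.nu x, e⟫}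
  have hG : IsOpen G := hU.inter (isOpen_lt continuous_const hcn)
  let O : Set (EuclideanSpace ℝ (Fin n)) := ι ⁻¹' (Φ.target ∩ Φ.symm ⁻¹' G)
  have hO : IsOpen O := (Φ.isOpen_inter_preimage_symm hG).preimage ι.continuous
  have hFΓ : ∀ u ∈ O, F (Φ.symm (ι u)) = ι u := fun u hu => Φ.right_inv hu.1
  have hfΓ : ∀ u ∈ O, f (Φ.symm (ι u)) = 0 := by
    intro u hu
    rw [← heF, hFΓ u hu, heι]
  have hΓM : ∀ u ∈ O, Φ.symm (ι u) ∈ M.carrier ∩ U := by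
    intro u hu
    rw [hMU]; exact ⟨hu.2.1, hfΓ u hu⟩
  have hfM : ∀ x ∈ M.carrier ∩ U, f x = 0 := by
    intro x hx; rw [hMU] at hx; exact hx.2
  have hFM : ∀ x ∈ M.carrier ∩ U, F x = ι (P x) := by
    intro x hx
    simp only [F, hfM x hx, hιP]; rw [zero_sub, neg_smul, sub_eq_add_neg]
  have hsm : ∀ u ∈ O, ContDiffAt ℝ 1 (fun u => Φ.symm (ι u)) u := by
    intro u hu
    obtain ⟨L, hL⟩ := hF' _ (hDe _ (hΓM u hu) hu.2.2)
    have := Φ.contDiffAt_symm (n := 1) hu.1 hL (hF.contDiffAt.of_le (by norm_cast))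
    exact ContDiffAt.comp u this ι.contDiff.contDiffAt
  refine ⟨⟨ι, P, hιP, hPι, heι, O, Φ.source ∩ G, hO, Φ.open_source.inter hG, ?_,
    fun u => Φ.symm (ι u), fun u hu => (hsm u hu).contDiffWithinAt, ?_, ?_, ?_, ?_, ?_, ?_⟩, ?_⟩
  · refine ⟨f ⁻¹' {0}, isClosed_singleton.preimage hfd.continuous, ?_⟩
    ext x
    constructor
    · rintro ⟨h1, h2⟩
      exact ⟨hfM x ⟨h1, h2.2.1⟩, h2⟩
    · rintro ⟨h1, h2⟩
      refine ⟨?_, h2⟩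
      have : x ∈ M.carrier ∩ U := by rw [hMU]; exact ⟨h2.2.1, h1⟩
      exact this.1
  · intro u hu
    exact ⟨(hΓM u hu).1, Φ.map_target hu.1, hu.2⟩
  · intro u hu
    rw [← hPF, hFΓ u hu, hPι]
  · intro x hx
    have h1 : ι (P x) = Φ x := (hFM x ⟨hx.1, hx.2.2.1⟩).symm
    refine ⟨?_, ?_⟩
    · rw [h1]; exact Φ.map_source hx.2.1
    · rw [Set.mem_preimage, h1, Φ.left_inv hx.2.1]; exact hx.2.2
  · intro x hx
    have h1 : ι (P x) = Φ x := (hFM x ⟨hx.1, hx.2.2.1⟩).symm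
    show Φ.symm (ι (P x)) = x
    rw [h1, Φ.left_inv hx.2.1]
  · intro x hx
    exact hx.2.2.2
  · intro u hu v
    rw [hnuf _ (hΓM u hu)]
    have h1 : HasFDerivAt (fun u => f (Φ.symm (ι u))) ((fderiv ℝ f (Φ.symm (ι u))).comp
        (fderiv ℝ (fun u => Φ.symm (ι u)) u)) u :=
      (hfd _).hasFDerivAt.comp u ((hsm u hu).differentiableAt (by simp)).hasFDerivAt
    have h2 : HasFDerivAt (fun u => f (Φ.symm (ι u))) (0 : _ →L[ℝ] ℝ) u := by
      refine (hasFDerivAt_const (0:ℝ) u).congr_of_eventuallyEq ?_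
      filter_upwards [hO.mem_nhds hu] with y hy using hfΓ y hy
    have := h1.unique h2
    have h3 := congrArg (fun T => T v) this
    simp only [ContinuousLinearMap.comp_apply] at h3
    rw [h3]; simp
  · exact ⟨hF.contDiffAt.mem_toOpenPartialHomeomorph_source hL (by simp), hpU, hpe⟩


open scoped Topology NNReal ENNReal in
theorem measure_le_of_locally {X : Type*} [TopologicalSpace X] [SecondCountableTopology X]
    [MeasurableSpace X] [OpensMeasurableSpace X] (μ ν : Measure X) (O : Set X) (h0 : μ Oᶜ = 0)
    (h : ∀ x ∈ O, ∃ t ∈ 𝓝 x, ∀ S ⊆ t, MeasurableSet S → μ S ≤ ν S) : μ ≤ ν := by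
  choose! t ht hS using h
  obtain ⟨c, hcO, hc, hcov⟩ := TopologicalSpace.countable_cover_nhdsWithin
    (f := fun x => interior (t x)) (s := O)
    (fun x hx => mem_nhdsWithin_of_mem_nhds (interior_mem_nhds.2 (ht x hx)))
  rw [Measure.le_iff]
  intro S hSm
  rcases c.eq_empty_or_nonempty with rfl | hne
  · have : O ⊆ ∅ := by simpa using hcov
    have h2 : Oᶜ = Set.univ := by rw [Set.subset_empty_iff.1 this]; simp
    rw [h2] at h0
    exact (measure_mono (Set.subset_univ S)).trans (by rw [h0]; simp)
  · obtain ⟨g, hg⟩ := hc.exists_eq_range hne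
    let A : ℕ → Set X := fun k => interior (t (g k))
    have hgO : ∀ k, g k ∈ O := fun k => hcO (by rw [hg]; exact ⟨k, rfl⟩)
    have hAm : ∀ k, MeasurableSet (A k) := fun k => isOpen_interior.measurableSet
    have hDm : ∀ k, MeasurableSet (disjointed A k) := MeasurableSet.disjointed hAm
    have hOA : O ⊆ ⋃ k, A k := by
      intro x hx
      have := hcov hx
      rw [hg] at this
      simpa using this
    have hsplit : ∀ m : Measure X, m (S ∩ ⋃ k, A k) = ∑' k, m (S ∩ disjointed A k) := by
      intro m
      rw [← iUnion_disjointed, Set.inter_iUnion, measure_iUnion]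
      · intro i j hij
        exact (disjoint_disjointed A hij).mono Set.inter_subset_right Set.inter_subset_right
      · exact fun k => hSm.inter (hDm k)
    calc μ S ≤ μ ((S ∩ ⋃ k, A k) ∪ Oᶜ) := by
          apply measure_mono
          intro x hx
          by_cases hxO : x ∈ O
          · exact Or.inl ⟨hx, hOA hxO⟩
          · exact Or.inr hxO
      _ ≤ μ (S ∩ ⋃ k, A k) + μ Oᶜ := measure_union_le _ _
      _ = ∑' k, μ (S ∩ disjointed A k) := by rw [h0, add_zero, hsplit]
      _ ≤ ∑' k, ν (S ∩ disjointed A k) := by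
          refine ENNReal.tsum_le_tsum fun k => hS (g k) (hgO k) _ ?_ (hSm.inter (hDm k))
          exact Set.inter_subset_right.trans ((disjointed_subset A k).trans interior_subset)
      _ = ν (S ∩ ⋃ k, A k) := (hsplit ν).symm
      _ ≤ ν S := measure_mono Set.inter_subset_left

open scoped Topology NNReal ENNReal in
theorem hausdorff_le_of_dist {X Y Z : Type*} [MetricSpace Y] [MeasurableSpace Y] [BorelSpace Y]
    [MetricSpace Z] [MeasurableSpace Z] [BorelSpace Z] (f : X → Y) (g : X → Z) (S : Set X)
    (c : ℝ≥0) (h : ∀ x ∈ S, ∀ y ∈ S, dist (f x) (f y) ≤ c * dist (g x) (g y)) (d : ℕ) :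
    μH[(d : ℝ)] (f '' S) ≤ (c : ℝ≥0∞) ^ d * μH[(d : ℝ)] (g '' S) := by
  rcases S.eq_empty_or_nonempty with rfl | ⟨x0, hx0⟩
  · simp
  haveI : Nonempty X := ⟨x0⟩
  let k := Function.invFunOn g S
  have hk : ∀ x ∈ S, k (g x) ∈ S ∧ g (k (g x)) = g x := fun x hx =>
    Function.invFunOn_pos (f := g) (s := S) (b := g x) ⟨x, hx, rfl⟩
  have hfk : ∀ x ∈ S, f (k (g x)) = f x := by
    intro x hx
    have := h _ (hk x hx).1 x hx
    rw [(hk x hx).2, dist_self, mul_zero] at this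
    exact dist_le_zero.1 this
  have himg : f '' S = (fun z => f (k z)) '' (g '' S) := by
    rw [Set.image_image]
    exact Set.image_congr fun x hx => (hfk x hx).symm
  have hL : LipschitzOnWith c (fun z => f (k z)) (g '' S) := by
    apply LipschitzOnWith.of_dist_le_mul
    rintro _ ⟨x, hx, rfl⟩ _ ⟨y, hy, rfl⟩
    simp only [hfk x hx, hfk y hy]
    exact h x hx y hy
  have := hL.hausdorffMeasure_image_le (d := (d : ℝ)) (by positivity)
  rw [himg]
  simpa using this

namespace Patch
variable {M : Hypersurface n} {e : Eu n} (Q : Patch M e)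

theorem inner_P (x : Eu n) (v) : ⟪Q.P x, v⟫ = ⟪x, Q.ι v⟫ := by
  rw [← Q.ι.inner_map_map, Q.ι_P, inner_sub_left, real_inner_smul_left, Q.e_ι]; simp

theorem diffAt {u} (hu : u ∈ Q.O) : DifferentiableAt ℝ Q.Γ u :=
  ((Q.smooth u hu).contDiffAt (Q.O_open.mem_nhds hu)).differentiableAt (by simp)

theorem contAt {u} (hu : u ∈ Q.O) : ContinuousAt Q.Γ u := (Q.diffAt hu).continuousAt

theorem fderiv_Γ {u} (hu : u ∈ Q.O) (v) :
    fderiv ℝ Q.Γ u v = Q.ι v - (⟪M.nu (Q.Γ u), Q.ι v⟫ / ⟪M.nu (Q.Γ u), e⟫) • e := by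
  have h1 : HasFDerivAt (fun u => Q.P (Q.Γ u)) (Q.P.comp (fderiv ℝ Q.Γ u)) u :=
    Q.P.hasFDerivAt.comp u (Q.diffAt hu).hasFDerivAt
  have h2 : HasFDerivAt (fun u => Q.P (Q.Γ u)) (ContinuousLinearMap.id ℝ _) u := by
    refine (hasFDerivAt_id u).congr_of_eventuallyEq ?_
    filter_upwards [Q.O_open.mem_nhds hu] with y hy using Q.P_Γ y hy
  have h3 : Q.P (fderiv ℝ Q.Γ u v) = v := by
    simpa using congrArg (fun T => T v) (h1.unique h2)
  have h4 := Q.ι_P (fderiv ℝ Q.Γ u v)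
  rw [h3] at h4
  have h5 := Q.tang u hu v
  have hpos := Q.pos _ (Q.Γ_mem u hu)
  set D := fderiv ℝ Q.Γ u v
  have h6 : D = Q.ι v + ⟪e, D⟫ • e := by rw [h4]; simp
  have h7 : ⟪M.nu (Q.Γ u), Q.ι v⟫ + ⟪e, D⟫ * ⟪M.nu (Q.Γ u), e⟫ = 0 := by
    rw [h6, inner_add_right, inner_smul_right] at h5; exact h5
  have h8 : ⟪M.nu (Q.Γ u), Q.ι v⟫ / ⟪M.nu (Q.Γ u), e⟫ = - ⟪e, D⟫ := by
    rw [div_eq_iff hpos.ne']; linarith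
  rw [h8, neg_smul, sub_neg_eq_add]; exact h6

theorem normsq_P (he : ‖e‖ = 1) {x} (hx : x ∈ M.carrier) :
    ⟪M.nu x, Q.ι (Q.P (M.nu x))⟫ = 1 - ⟪M.nu x, e⟫ ^ 2 := by
  rw [Q.ι_P, inner_sub_right, inner_smul_right, real_inner_self_eq_norm_sq, M.unit_nu x hx,
    real_inner_comm]
  ring

theorem exists_T (he : ‖e‖ = 1) {u} (hu : u ∈ Q.O) :
    ∃ T : EuclideanSpace ℝ (Fin n) →ₗ[ℝ] EuclideanSpace ℝ (Fin n),
      LinearMap.det T = ⟪M.nu (Q.Γ u), e⟫⁻¹ ∧ ∀ v, ‖T v‖ = ‖fderiv ℝ Q.Γ u v‖ := by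
  have hpos := Q.pos _ (Q.Γ_mem u hu)
  have hM := (Q.Γ_mem u hu).1
  have hN := Q.normsq_P he hM
  set N := M.nu (Q.Γ u)
  set a := ⟪N, e⟫ with ha
  let f : Module.Dual ℝ (EuclideanSpace ℝ (Fin n)) :=
    (innerSL ℝ N).toLinearMap ∘ₗ Q.ι.toLinearMap
  have hf : ∀ v, f v = ⟪N, Q.ι v⟫ := fun v => rfl
  refine ⟨LinearMap.transvection f ((a * (1 + a))⁻¹ • Q.P N), ?_, ?_⟩
  · rw [LinearMap.transvection.det, map_smul, hf, hN, smul_eq_mul]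
    have : 1 + a ≠ 0 := by positivity
    field_simp
    ring
  · intro v
    have h1 : ‖LinearMap.transvection f ((a * (1 + a))⁻¹ • Q.P N) v‖ ^ 2
        = ‖v‖ ^ 2 + (f v) ^ 2 / a ^ 2 := by
      have hPP : ‖Q.P N‖ ^ 2 = 1 - a ^ 2 := by
        rw [← real_inner_self_eq_norm_sq, Q.inner_P, hN]
      have hvP : ⟪v, Q.P N⟫ = f v := by rw [real_inner_comm, Q.inner_P]; rfl
      rw [LinearMap.transvection.apply, norm_add_sq_real, smul_smul, inner_smul_right, norm_smul,
        mul_pow, hPP, hvP, Real.norm_eq_abs, sq_abs]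
      have : 1 + a ≠ 0 := by positivity
      field_simp
      ring
    have h2 : ‖fderiv ℝ Q.Γ u v‖ ^ 2 = ‖v‖ ^ 2 + (f v) ^ 2 / a ^ 2 := by
      rw [Q.fderiv_Γ hu, norm_sub_sq_real, inner_smul_right, real_inner_comm e (Q.ι v), Q.e_ι, norm_smul, he,
        Q.ι.norm_map, Real.norm_eq_abs, mul_one, sq_abs, div_pow, hf]
      ring
    rw [← h2] at h1
    exact (pow_left_inj₀ (norm_nonneg _) (norm_nonneg _) two_ne_zero).1 h1

open scoped Topology NNReal ENNReal in
theorem approx (he : ‖e‖ = 1) {u} (hu : u ∈ Q.O) (c : ℝ≥0) (hc : 1 < c) :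
    ∃ T : EuclideanSpace ℝ (Fin n) →ₗ[ℝ] EuclideanSpace ℝ (Fin n),
      LinearMap.det T = ⟪M.nu (Q.Γ u), e⟫⁻¹ ∧ ∃ t ∈ 𝓝 u, t ⊆ Q.O ∧
      (∀ x ∈ t, ⟪M.nu (Q.Γ x), e⟫⁻¹ ≤ c * ⟪M.nu (Q.Γ u), e⟫⁻¹ ∧
        ⟪M.nu (Q.Γ u), e⟫⁻¹ ≤ c * ⟪M.nu (Q.Γ x), e⟫⁻¹) ∧
      (∀ x ∈ t, ∀ y ∈ t, dist (Q.Γ x) (Q.Γ y) ≤ c * dist (T x) (T y)) ∧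
      (∀ x ∈ t, ∀ y ∈ t, dist (T x) (T y) ≤ c * dist (Q.Γ x) (Q.Γ y)) := by
  obtain ⟨T, hdet, hT⟩ := Q.exists_T he hu
  have hpos := Q.pos _ (Q.Γ_mem u hu)
  refine ⟨T, hdet, ?_⟩
  have hdet0 : LinearMap.det T ≠ 0 := by rw [hdet]; positivity
  let T' := (T.equivOfDetNeZero hdet0).toContinuousLinearEquiv
  have hT' : ∀ x, T' x = T x := fun x => rfl
  obtain ⟨K, hK⟩ : ∃ K : ℝ, 0 < K ∧ ∀ x, ‖x‖ ≤ K * ‖T x‖ := by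
    refine ⟨‖(T'.symm : EuclideanSpace ℝ (Fin n) →L[ℝ] EuclideanSpace ℝ (Fin n))‖ + 1, by positivity, fun x => ?_⟩
    have := (T'.symm : EuclideanSpace ℝ (Fin n) →L[ℝ] EuclideanSpace ℝ (Fin n)).le_opNorm (T' x)
    simp only [ContinuousLinearEquiv.coe_coe, ContinuousLinearEquiv.symm_apply_apply] at this
    rw [hT'] at this
    nlinarith [norm_nonneg (T x)]
  have hc' : (1:ℝ) < c := by exact_mod_cast hc
  have hstrict : HasStrictFDerivAt Q.Γ (fderiv ℝ Q.Γ u) u :=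
    ((Q.smooth u hu).contDiffAt (Q.O_open.mem_nhds hu)).hasStrictFDerivAt (by simp)
  let δ : ℝ≥0 := ⟨(c - 1) / (c * K), div_nonneg (by linarith) (by have := hK.1; positivity)⟩
  have hδ : 0 < δ := by
    show (0:ℝ) < (c - 1) / (c * K)
    have := hK.1
    exact div_pos (by linarith) (by positivity)
  have hδK : (δ : ℝ) * K = (c - 1) / c := by
    have := hK.1
    show (c - 1) / (c * K) * K = (c - 1) / (c:ℝ)
    field_simp
  obtain ⟨s, hs, hsA⟩ := hstrict.approximates_deriv_on_nhds (c := δ) (Or.inr hδ)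
  have hcont : ContinuousAt (fun x => ⟪M.nu (Q.Γ x), e⟫⁻¹) u := by
    have h1 : ContinuousAt (fun x => ⟪M.nu (Q.Γ x), e⟫) u :=
      ((M.smooth_nu.continuous.continuousAt.comp (Q.contAt hu)).inner continuousAt_const)
    exact h1.inv₀ hpos.ne'
  set k := ⟪M.nu (Q.Γ u), e⟫⁻¹ with hk
  have hkpos : 0 < k := by positivity
  have e1 : ∀ᶠ x in 𝓝 u, ⟪M.nu (Q.Γ x), e⟫⁻¹ < c * k :=
    hcont.eventually_lt continuousAt_const (by rw [← hk]; nlinarith)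
  have e2 : ∀ᶠ x in 𝓝 u, k < c * ⟪M.nu (Q.Γ x), e⟫⁻¹ :=
    continuousAt_const.eventually_lt (hcont.const_mul (c:ℝ)) (by rw [← hk]; nlinarith)
  refine ⟨(s ∩ Q.O) ∩ {x | ⟪M.nu (Q.Γ x), e⟫⁻¹ < c * k ∧ k < c * ⟪M.nu (Q.Γ x), e⟫⁻¹},
    Filter.inter_mem (Filter.inter_mem hs (Q.O_open.mem_nhds hu)) (e1.and e2), ?_, ?_, ?_, ?_⟩
  · exact fun x hx => hx.1.2
  · exact fun x hx => ⟨hx.2.1.le, hx.2.2.le⟩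
  all_goals
    intro x hx y hy
    have h1 := hsA x hx.1.1 y hy.1.1
    rw [dist_eq_norm, dist_eq_norm, ← map_sub]
    have h2 := hK.2 (x - y)
    have h3 : ‖Q.Γ x - Q.Γ y - fderiv ℝ Q.Γ u (x - y)‖ ≤ (c - 1) / c * ‖T (x - y)‖ := by
      rw [← hδK]
      calc _ ≤ _ := h1
        _ ≤ δ * (K * ‖T (x - y)‖) := by gcongr
        _ = _ := by ring
    have h4 := norm_sub_norm_le (Q.Γ x - Q.Γ y) (fderiv ℝ Q.Γ u (x - y))
    have h5 := norm_sub_norm_le (fderiv ℝ Q.Γ u (x - y)) (Q.Γ x - Q.Γ y)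
    rw [norm_sub_rev (fderiv ℝ Q.Γ u (x - y))] at h5
    rw [← hT] at h4 h5
    have h0 := norm_nonneg (T (x - y))
    have hcc : ((c:ℝ) - 1) / c = 1 - 1 / c := by field_simp
  · have : ((c:ℝ) - 1) / c ≤ c - 1 := div_le_self (by linarith) hc'.le
    nlinarith
  · rw [hcc] at h3
    have h6 : (1 / (c:ℝ)) * ‖T (x - y)‖ ≤ ‖Q.Γ x - Q.Γ y‖ := by linarith
    have h7 : ‖T (x - y)‖ = c * ((1 / (c:ℝ)) * ‖T (x - y)‖) := by field_simp
    rw [h7]; gcongr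

theorem meas_W : MeasurableSet (M.carrier ∩ Q.W) := by
  obtain ⟨C, hC, h⟩ := Q.closedW
  rw [h]; exact hC.measurableSet.inter Q.W_open.measurableSet

theorem preimage_eq {S} (hS : S ⊆ Q.O) : Q.P ⁻¹' S ∩ (M.carrier ∩ Q.W) = Q.Γ '' S := by
  ext x
  constructor
  · rintro ⟨h1, h2⟩
    exact ⟨_, h1, Q.Γ_P x h2⟩
  · rintro ⟨u, hu, rfl⟩
    refine ⟨?_, Q.Γ_mem u (hS hu)⟩
    rw [Set.mem_preimage, Q.P_Γ u (hS hu)]; exact hu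

/-- pushforward of surface measure -/
def ρ : Measure (EuclideanSpace ℝ (Fin n)) :=
  ((μH[(n:ℝ)] : Measure (Eu n)).restrict (M.carrier ∩ Q.W)).map Q.P

/-- graph measure -/
def θ : Measure (EuclideanSpace ℝ (Fin n)) :=
  ((μH[(n:ℝ)]).restrict Q.O).withDensity fun u => ENNReal.ofReal (⟪M.nu (Q.Γ u), e⟫⁻¹)

theorem ρ_apply {S} (hSm : MeasurableSet S) (hS : S ⊆ Q.O) : Q.ρ S = μH[(n:ℝ)] (Q.Γ '' S) := by
  rw [ρ, Measure.map_apply Q.P.continuous.measurable hSm,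
    Measure.restrict_apply (Q.P.continuous.measurable hSm), Q.preimage_eq hS]

theorem θ_apply {S} (hSm : MeasurableSet S) (hS : S ⊆ Q.O) :
    Q.θ S = ∫⁻ u in S, ENNReal.ofReal (⟪M.nu (Q.Γ u), e⟫⁻¹) ∂(μH[(n:ℝ)]) := by
  rw [θ, withDensity_apply _ hSm, Measure.restrict_restrict hSm, Set.inter_eq_left.2 hS]

theorem ρ_compl : Q.ρ Q.Oᶜ = 0 := by
  rw [ρ, Measure.map_apply Q.P.continuous.measurable Q.O_open.measurableSet.compl,
    Measure.restrict_apply (Q.P.continuous.measurable Q.O_open.measurableSet.compl)]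
  convert measure_empty (μ := (μH[(n:ℝ)] : Measure (Eu n)))
  ext x
  simp only [Set.mem_inter_iff, Set.mem_preimage, Set.mem_compl_iff, Set.mem_empty_iff_false,
    iff_false, not_and]
  exact fun h h1 h2 => h (Q.P_mem x ⟨h1, h2⟩)

theorem θ_compl : Q.θ Q.Oᶜ = 0 := by
  rw [θ, withDensity_apply _ Q.O_open.measurableSet.compl,
    Measure.restrict_restrict Q.O_open.measurableSet.compl]
  simp

open scoped Topology NNReal ENNReal in
theorem local_bounds (he : ‖e‖ = 1) {u} (hu : u ∈ Q.O) (c : ℝ≥0) (hc : 1 < c) :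
    ∃ t ∈ 𝓝 u, ∀ S ⊆ t, MeasurableSet S → Q.ρ S ≤ (c : ℝ≥0∞) ^ (n + 1) * Q.θ S ∧
      Q.θ S ≤ (c : ℝ≥0∞) ^ (n + 1) * Q.ρ S := by
  obtain ⟨T, hdet, t, ht, htO, hb, h1, h2⟩ := Q.approx he hu c hc
  refine ⟨t, ht, fun S hS hSm => ?_⟩
  have hpos := Q.pos _ (Q.Γ_mem u hu)
  have g1 := hausdorff_le_of_dist Q.Γ T S c (fun x hx y hy => h1 x (hS hx) y (hS hy)) n
  have g2 := hausdorff_le_of_dist T Q.Γ S c (fun x hx y hy => h2 x (hS hx) y (hS hy)) n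
  rw [Measure.addHaar_image_linearMap, hdet, abs_of_pos (by positivity)] at g1 g2
  rw [Q.ρ_apply hSm (hS.trans htO), Q.θ_apply hSm (hS.trans htO)]
  set k := ⟪M.nu (Q.Γ u), e⟫⁻¹
  have cc : ENNReal.ofReal (c:ℝ) = (c : ℝ≥0∞) := ENNReal.ofReal_coe_nnreal
  have b1 : ENNReal.ofReal k * μH[(n:ℝ)] S
      ≤ c * ∫⁻ u in S, ENNReal.ofReal (⟪M.nu (Q.Γ u), e⟫⁻¹) ∂(μH[(n:ℝ)]) := by
    rw [← setLIntegral_const, ← lintegral_const_mul' _ _ ENNReal.coe_ne_top]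
    refine setLIntegral_mono' hSm fun x hx => ?_
    rw [← cc, ← ENNReal.ofReal_mul (by positivity)]
    exact ENNReal.ofReal_le_ofReal (hb x (hS hx)).2
  have b2 : ∫⁻ u in S, ENNReal.ofReal (⟪M.nu (Q.Γ u), e⟫⁻¹) ∂(μH[(n:ℝ)])
      ≤ c * (ENNReal.ofReal k * μH[(n:ℝ)] S) := by
    rw [← setLIntegral_const, ← lintegral_const_mul' _ _ ENNReal.coe_ne_top]
    refine setLIntegral_mono' hSm fun x hx => ?_
    rw [← cc, ← ENNReal.ofReal_mul (by positivity)]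
    exact ENNReal.ofReal_le_ofReal (hb x (hS hx)).1
  constructor
  · calc _ ≤ _ := g1
      _ ≤ _ := mul_le_mul_right b1 _
      _ = _ := by rw [pow_succ, mul_assoc]
  · calc _ ≤ _ := b2
      _ ≤ _ := mul_le_mul_right g2 _
      _ = _ := by rw [pow_succ']; ring

open scoped Topology NNReal ENNReal in
theorem le_of_forall_c {a b : ℝ≥0∞} (m : ℕ) (h : ∀ c : ℝ≥0, 1 < c → a ≤ (c:ℝ≥0∞) ^ m * b) :
    a ≤ b := by
  have h1 : Filter.Tendsto (fun c : ℝ≥0 => (c:ℝ≥0∞) ^ m * b) (𝓝[>] 1) (𝓝 (((1:ℝ≥0):ℝ≥0∞) ^ m * b)) := by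
    apply ENNReal.Tendsto.mul_const
    · have : Continuous fun c : ℝ≥0 => (c:ℝ≥0∞) ^ m := by fun_prop
      exact (this.tendsto 1).mono_left nhdsWithin_le_nhds
    · left; simp
  have h2 := ge_of_tendsto h1 (b := a) (by
    filter_upwards [self_mem_nhdsWithin] with c hc using h c hc)
  simpa using h2

theorem ρ_eq_θ (he : ‖e‖ = 1) : Q.ρ = Q.θ := by
  apply le_antisymm
  · rw [Measure.le_iff]
    intro S hS
    refine le_of_forall_c (n + 1) fun c hc => ?_
    have := measure_le_of_locally Q.ρ ((c:ENNReal) ^ (n+1) • Q.θ) Q.O Q.ρ_compl (by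
      intro x hx
      obtain ⟨t, ht, h⟩ := Q.local_bounds he hx c hc
      exact ⟨t, ht, fun S hS hSm => (h S hS hSm).1⟩)
    exact this S
  · rw [Measure.le_iff]
    intro S hS
    refine le_of_forall_c (n + 1) fun c hc => ?_
    have := measure_le_of_locally Q.θ ((c:ENNReal) ^ (n+1) • Q.ρ) Q.O Q.θ_compl (by
      intro x hx
      obtain ⟨t, ht, h⟩ := Q.local_bounds he hx c hc
      exact ⟨t, ht, fun S hS hSm => (h S hS hSm).2⟩)
    exact this S
end Patch


theorem vec_eq_sum {m : ℕ} (v : EuclideanSpace ℝ (Fin m)) :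
    v = ∑ j, v j • EuclideanSpace.single j (1:ℝ) := by
  ext i
  simp [Finset.sum_apply, Pi.single_apply]

theorem inner_eq_sum {m : ℕ} (v w : EuclideanSpace ℝ (Fin m)) : ⟪v, w⟫ = ∑ j, v j * w j := by
  simp [PiLp.inner_apply, mul_comm]

theorem inner_single_r {m : ℕ} (v : EuclideanSpace ℝ (Fin m)) (j : Fin m) :
    ⟪v, EuclideanSpace.single j (1:ℝ)⟫ = v j := by
  rw [inner_eq_sum]; simp [Pi.single_apply]

theorem inner_single_l {m : ℕ} (v : EuclideanSpace ℝ (Fin m)) (j : Fin m) :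
    ⟪EuclideanSpace.single j (1:ℝ), v⟫ = v j := by
  rw [real_inner_comm, inner_single_r]

theorem tderiv_eq (ν : Eu n → Eu n) (i : Fin (n+1)) (φ : Eu n → ℝ) (x : Eu n) :
    tderiv ν i φ x = fderiv ℝ φ x (EuclideanSpace.single i 1 - ν x i • ν x) := by
  rw [tderiv, map_sub, map_smul, smul_eq_mul]
  congr 2
  conv_rhs => rw [vec_eq_sum (ν x)]
  rw [map_sum]
  simp [mul_comm]

theorem meanCurv_eq (M : Hypersurface n) (x : Eu n) :
    meanCurv M x = ∑ i, (fderiv ℝ M.nu x (EuclideanSpace.single i 1)) i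
      - ⟪fderiv ℝ M.nu x (M.nu x), M.nu x⟫ := by
  have hd : DifferentiableAt ℝ M.nu x := M.smooth_nu.differentiable (by simp) x
  have h : ∀ i w, fderiv ℝ (fun y => M.nu y i) x w = (fderiv ℝ M.nu x w) i := by
    intro i w
    have h1 : HasFDerivAt (fun y => M.nu y i)
        ((EuclideanSpace.proj (𝕜 := ℝ) i : Eu n →L[ℝ] ℝ).comp (fderiv ℝ M.nu x)) x :=
      (EuclideanSpace.proj (𝕜 := ℝ) i : Eu n →L[ℝ] ℝ).hasFDerivAt.comp x hd.hasFDerivAt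
    rw [h1.fderiv]; rfl
  rw [meanCurv, tdiv, inner_eq_sum, ← Finset.sum_sub_distrib]
  refine Finset.sum_congr rfl fun i _ => ?_
  rw [tderiv_eq, h, map_sub, map_smul]
  simp [mul_comm]

namespace Patch
variable {M : Hypersurface n} {e : Eu n} (Q : Patch M e)

theorem ι_P_sum (x : Eu n) : Q.ι (Q.P x)
    = ∑ j, ⟪x, Q.ι (EuclideanSpace.single j 1)⟫ • Q.ι (EuclideanSpace.single j 1) := by
  conv_lhs => rw [vec_eq_sum (Q.P x)]
  rw [map_sum]
  refine Finset.sum_congr rfl fun j _ => ?_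
  rw [map_smul, ← Q.inner_P, inner_single_r]

theorem trace_split (L : Eu n →L[ℝ] Eu n) :
    ∑ i, (L (EuclideanSpace.single i 1)) i
      = ∑ j, ⟪L (Q.ι (EuclideanSpace.single j 1)), Q.ι (EuclideanSpace.single j 1)⟫ + ⟪L e, e⟫ := by
  have h : ∀ i, (L (EuclideanSpace.single i 1)) i
      = ∑ j, (Q.ι (EuclideanSpace.single j 1)) i * (L (Q.ι (EuclideanSpace.single j 1))) i
        + e i * (L e) i := by
    intro i
    have h1 : (EuclideanSpace.single i (1:ℝ) : Eu n) = Q.ι (Q.P (EuclideanSpace.single i 1)) + e i • e := by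
      rw [Q.ι_P, inner_single_r]; simp
    conv_lhs => rw [h1, map_add, map_smul, Q.ι_P_sum, map_sum]
    simp [inner_single_l]
  simp_rw [h, inner_eq_sum]
  rw [Finset.sum_add_distrib, Finset.sum_comm]
  simp [mul_comm]

theorem fderiv_Γ_PN (he : ‖e‖ = 1) {u} (hu : u ∈ Q.O) :
    fderiv ℝ Q.Γ u (Q.P (M.nu (Q.Γ u))) = M.nu (Q.Γ u) - ⟪M.nu (Q.Γ u), e⟫⁻¹ • e := by
  have hpos := Q.pos _ (Q.Γ_mem u hu)
  rw [Q.fderiv_Γ hu, Q.normsq_P he (Q.Γ_mem u hu).1, Q.ι_P, sub_sub, ← add_smul]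
  congr 2
  rw [real_inner_comm]
  field_simp
  ring

theorem hasFDerivAt_nuΓ {u} (hu : u ∈ Q.O) : HasFDerivAt (fun u => M.nu (Q.Γ u))
    ((fderiv ℝ M.nu (Q.Γ u)).comp (fderiv ℝ Q.Γ u)) u :=
  (M.smooth_nu.differentiable (by simp) _).hasFDerivAt.comp u (Q.diffAt hu).hasFDerivAt

theorem dnu_orth {u} (hu : u ∈ Q.O) (v) :
    ⟪fderiv ℝ M.nu (Q.Γ u) (fderiv ℝ Q.Γ u v), M.nu (Q.Γ u)⟫ = 0 := by
  have h1 := (Q.hasFDerivAt_nuΓ hu).norm_sq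
  have h2 : HasFDerivAt (fun u => ‖M.nu (Q.Γ u)‖ ^ 2) (0 : _ →L[ℝ] ℝ) u := by
    refine (hasFDerivAt_const (1:ℝ) u).congr_of_eventuallyEq ?_
    filter_upwards [Q.O_open.mem_nhds hu] with y hy
    rw [M.unit_nu _ (Q.Γ_mem y hy).1]; norm_num
  have h3 := congrArg (fun T => T v) (h1.unique h2)
  simp at h3
  rw [real_inner_comm]; exact h3

/-- components of the normal -/
def Nc (j : Fin n) (u : EuclideanSpace ℝ (Fin n)) : ℝ :=
  ⟪M.nu (Q.Γ u), Q.ι (EuclideanSpace.single j 1)⟫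

theorem fderiv_Nc {u} (hu : u ∈ Q.O) (j v) : fderiv ℝ (Q.Nc j) u v =
    ⟪fderiv ℝ M.nu (Q.Γ u) (fderiv ℝ Q.Γ u v), Q.ι (EuclideanSpace.single j 1)⟫ := by
  have := ((Q.hasFDerivAt_nuΓ hu).inner ℝ (hasFDerivAt_const (Q.ι (EuclideanSpace.single j 1)) u)).fderiv
  unfold Nc
  rw [this]
  simp

theorem Nc_contDiffOn (j) : ContDiffOn ℝ 1 (Q.Nc j) Q.O := by
  have h1 : ContDiff ℝ 1 M.nu := M.smooth_nu.of_le (by norm_cast)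
  exact (h1.comp_contDiffOn Q.smooth).inner ℝ contDiffOn_const

theorem div_zero' (he : ‖e‖ = 1) (hmin : ∀ x ∈ M.carrier, meanCurv M x = 0) {u} (hu : u ∈ Q.O) :
    ∑ j, fderiv ℝ (Q.Nc j) u (EuclideanSpace.single j 1) = 0 := by
  have hpos := Q.pos _ (Q.Γ_mem u hu)
  have hH := hmin _ (Q.Γ_mem u hu).1
  rw [meanCurv_eq, Q.trace_split] at hH
  have ho := Q.dnu_orth hu (Q.P (M.nu (Q.Γ u)))
  rw [Q.fderiv_Γ_PN he hu, map_sub, map_smul, inner_sub_left, real_inner_smul_left] at ho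
  have hs := congrArg (fun z => ⟪fderiv ℝ M.nu (Q.Γ u) e, z⟫) (Q.ι_P_sum (M.nu (Q.Γ u)))
  simp only [Q.ι_P, inner_sub_right, inner_sum, inner_smul_right] at hs
  simp_rw [Q.fderiv_Nc hu, Q.fderiv_Γ hu, map_sub, map_smul, inner_sub_left, real_inner_smul_left]
  rw [Finset.sum_sub_distrib]
  simp_rw [div_mul_eq_mul_div]
  rw [← Finset.sum_div, ← hs]
  rw [real_inner_comm (M.nu (Q.Γ u)) e]
  field_simp at ho ⊢
  linear_combination ⟪M.nu (Q.Γ u), e⟫ * hH + ho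

theorem integrable_aux {k : EuclideanSpace ℝ (Fin n) → ℝ} {K O : Set (EuclideanSpace ℝ (Fin n))}
    (hK : IsCompact K) (hKO : K ⊆ O) (hk : ContinuousOn k O) (h0 : ∀ u ∉ K, k u = 0) :
    Integrable k (μH[(n:ℝ)]) := by
  rw [← integrableOn_iff_integrable_of_support_subset (s := K)]
  · exact (hk.mono hKO).integrableOn_compact hK
  · intro u hu
    by_contra h
    exact hu (h0 u h)

theorem local_div (he : ‖e‖ = 1) (hmin : ∀ x ∈ M.carrier, meanCurv M x = 0) (ψ : Eu n → ℝ)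
    (hψ : ContDiff ℝ 1 ψ) (hcs : HasCompactSupport ψ) (hsub : tsupport ψ ⊆ Q.W) :
    ∫ x, fderiv ℝ ψ x (e - ⟪M.nu x, e⟫ • M.nu x) ∂surfMeasure M = 0 := by
  classical
  set g : Eu n → ℝ := fun x => fderiv ℝ ψ x (e - ⟪M.nu x, e⟫ • M.nu x) with hg
  have hnuc : Continuous M.nu := M.smooth_nu.continuous
  have hgc : Continuous g := by
    have h1 : Continuous (fderiv ℝ ψ) := hψ.continuous_fderiv (by simp)
    have h2 : Continuous fun x => ⟪M.nu x, e⟫ • M.nu x :=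
      Continuous.smul (hnuc.inner (𝕜 := ℝ) (continuous_const (y := e))) hnuc
    exact h1.clm_apply (continuous_const.sub h2)
  have hg0 : ∀ x, x ∉ Q.W → g x = 0 := by
    intro x hx
    have : fderiv ℝ ψ x = 0 := by
      by_contra h
      exact hx (hsub (support_fderiv_subset ℝ (f := ψ) h))
    simp [hg, this]
  have hΓc : ContinuousOn Q.Γ Q.O := Q.smooth.continuousOn
  -- step 1
  have s1 : ∫ x, g x ∂surfMeasure M = ∫ x in M.carrier ∩ Q.W, g x ∂(μH[(n:ℝ)]) := by
    rw [← setIntegral_eq_integral_of_forall_compl_eq_zero hg0, surfMeasure,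
      Measure.restrict_restrict Q.W_open.measurableSet, Set.inter_comm]
  have s2 : ∫ x in M.carrier ∩ Q.W, g x ∂(μH[(n:ℝ)])
      = ∫ x in M.carrier ∩ Q.W, g (Q.Γ (Q.P x)) ∂(μH[(n:ℝ)]) := by
    refine setIntegral_congr_fun Q.meas_W fun x hx => ?_
    simp only [Q.Γ_P x hx]
  have hgΓ : ContinuousOn (fun u => g (Q.Γ u)) Q.O := hgc.comp_continuousOn hΓc
  have hOm := Q.O_open.measurableSet
  have hm : AEStronglyMeasurable (fun u => g (Q.Γ u)) Q.θ :=
    (hgΓ.aestronglyMeasurable hOm).mono_ac (withDensity_absolutelyContinuous _ _)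
  have s3 : ∫ x in M.carrier ∩ Q.W, g (Q.Γ (Q.P x)) ∂(μH[(n:ℝ)]) = ∫ u, g (Q.Γ u) ∂Q.θ := by
    rw [← Q.ρ_eq_θ he, ρ, integral_map (f := fun u => g (Q.Γ u))]
    · exact Q.P.continuous.measurable.aemeasurable
    · have := hm
      rwa [← Q.ρ_eq_θ he] at this
  have hac : ContinuousOn (fun u => ⟪M.nu (Q.Γ u), e⟫⁻¹) Q.O := by
    refine ContinuousOn.inv₀ ((hnuc.comp_continuousOn hΓc).inner continuousOn_const) ?_
    exact fun u hu => (Q.pos _ (Q.Γ_mem u hu)).ne'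
  have s4 : ∫ u, g (Q.Γ u) ∂Q.θ
      = ∫ u in Q.O, ⟪M.nu (Q.Γ u), e⟫⁻¹ * g (Q.Γ u) ∂(μH[(n:ℝ)]) := by
    rw [θ, integral_withDensity_eq_integral_toReal_smul₀]
    · refine setIntegral_congr_fun hOm fun u hu => ?_
      have := Q.pos _ (Q.Γ_mem u hu)
      simp only [smul_eq_mul]
      rw [ENNReal.toReal_ofReal (by positivity)]
    · exact (hac.aemeasurable hOm).ennreal_ofReal
    · exact Filter.Eventually.of_forall fun _ => ENNReal.ofReal_lt_top
  -- the function on the parameter domain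
  obtain ⟨C, hC, hCW⟩ := Q.closedW
  let K := Q.P '' (tsupport ψ ∩ C)
  have hK : IsCompact K := (hcs.isCompact.inter_right hC).image Q.P.continuous
  have hKO : K ⊆ Q.O := by
    rintro _ ⟨x, hx, rfl⟩
    apply Q.P_mem
    rw [hCW]; exact ⟨hx.2, hsub hx.1⟩
  let h : EuclideanSpace ℝ (Fin n) → ℝ := Q.O.indicator fun u => ψ (Q.Γ u)
  have h_eq : ∀ u ∈ Q.O, h u = ψ (Q.Γ u) := fun u hu => Set.indicator_of_mem hu _
  have h0 : ∀ u ∉ K, h u = 0 := by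
    intro u hu
    by_cases huO : u ∈ Q.O
    · rw [h_eq u huO]
      by_contra hne
      apply hu
      refine ⟨Q.Γ u, ⟨subset_tsupport _ hne, ?_⟩, Q.P_Γ u huO⟩
      have := Q.Γ_mem u huO
      rw [hCW] at this; exact this.1
    · exact Set.indicator_of_notMem huO _
  have htK : tsupport h ⊆ K := by
    apply closure_minimal _ hK.isClosed
    intro u hu
    by_contra hh
    exact hu (h0 u hh)
  have hd0 : ∀ u ∉ K, fderiv ℝ h u = 0 := by
    intro u hu
    by_contra hne
    exact hu (htK (support_fderiv_subset ℝ (f := h) hne))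
  have h_ev : ∀ u ∈ Q.O, h =ᶠ[nhds u] fun u => ψ (Q.Γ u) := by
    intro u hu
    filter_upwards [Q.O_open.mem_nhds hu] with y hy using h_eq y hy
  have hC1 : ContDiff ℝ 1 h := by
    rw [contDiff_iff_contDiffAt]
    intro u
    by_cases hu : u ∈ tsupport h
    swap
    · exact contDiffAt_const.congr_of_eventuallyEq (notMem_tsupport_iff_eventuallyEq.1 hu)
    have huO := hKO (htK hu)
    refine ContDiffAt.congr_of_eventuallyEq ?_ (h_ev u huO)
    exact hψ.contDiffAt.comp u ((Q.smooth u huO).contDiffAt (Q.O_open.mem_nhds huO))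
  have hdh : ∀ u ∈ Q.O, ∀ v, fderiv ℝ h u v = fderiv ℝ ψ (Q.Γ u) (fderiv ℝ Q.Γ u v) := by
    intro u hu v
    have h1 : HasFDerivAt (fun u => ψ (Q.Γ u)) ((fderiv ℝ ψ (Q.Γ u)).comp (fderiv ℝ Q.Γ u)) u :=
      (hψ.differentiable (by simp) _).hasFDerivAt.comp u (Q.diffAt hu).hasFDerivAt
    rw [(h_ev u hu).fderiv_eq, h1.fderiv]; rfl
  have s5 : ∫ u in Q.O, ⟪M.nu (Q.Γ u), e⟫⁻¹ * g (Q.Γ u) ∂(μH[(n:ℝ)])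
      = ∫ u in Q.O, - ∑ j, Q.Nc j u * fderiv ℝ h u (EuclideanSpace.single j 1) ∂(μH[(n:ℝ)]) := by
    refine setIntegral_congr_fun hOm fun u hu => ?_
    have hpos := Q.pos _ (Q.Γ_mem u hu)
    have h1 : ∑ j, Q.Nc j u * fderiv ℝ h u (EuclideanSpace.single j 1)
        = fderiv ℝ h u (Q.P (M.nu (Q.Γ u))) := by
      conv_rhs => rw [vec_eq_sum (Q.P (M.nu (Q.Γ u))), map_sum]
      refine Finset.sum_congr rfl fun j _ => ?_
      rw [map_smul, Nc, ← Q.inner_P, inner_single_r, smul_eq_mul]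
    show ⟪M.nu (Q.Γ u), e⟫⁻¹ * fderiv ℝ ψ (Q.Γ u) (e - ⟪M.nu (Q.Γ u), e⟫ • M.nu (Q.Γ u))
      = - ∑ j, Q.Nc j u * fderiv ℝ h u (EuclideanSpace.single j 1)
    rw [h1, hdh u hu, Q.fderiv_Γ_PN he hu]
    rw [← smul_eq_mul, ← map_smul, ← map_neg]
    congr 1
    rw [smul_sub, smul_smul, inv_mul_cancel₀ hpos.ne', one_smul]
    abel
  have s6 : ∫ u in Q.O, - ∑ j, Q.Nc j u * fderiv ℝ h u (EuclideanSpace.single j 1) ∂(μH[(n:ℝ)])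
      = ∫ u, - ∑ j, Q.Nc j u * fderiv ℝ h u (EuclideanSpace.single j 1) ∂(μH[(n:ℝ)]) := by
    apply setIntegral_eq_integral_of_forall_compl_eq_zero
    intro u hu
    rw [hd0 u (fun hh => hu (hKO hh))]
    simp
  have hdc : Continuous (fderiv ℝ h) := hC1.continuous_fderiv (by simp)
  have hNc : ∀ j, ContinuousOn (Q.Nc j) Q.O := fun j => (Q.Nc_contDiffOn j).continuousOn
  have i1 : ∀ j, Integrable (fun u => Q.Nc j u * fderiv ℝ h u (EuclideanSpace.single j 1)) (μH[(n:ℝ)]) := by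
    intro j
    refine integrable_aux hK hKO ((hNc j).mul (hdc.clm_apply continuous_const).continuousOn) ?_
    intro u hu; rw [hd0 u hu]; simp
  have hNd : ∀ j, ContinuousOn (fun u => fderiv ℝ (Q.Nc j) u (EuclideanSpace.single j 1)) Q.O := by
    intro j
    exact ((Q.Nc_contDiffOn j).continuousOn_fderiv_of_isOpen Q.O_open (by simp)).clm_apply continuousOn_const
  have i2 : ∀ j, Integrable (fun u => fderiv ℝ (Q.Nc j) u (EuclideanSpace.single j 1) * h u) (μH[(n:ℝ)]) := by
    intro j
    refine integrable_aux hK hKO ((hNd j).mul hC1.continuous.continuousOn) ?_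
    intro u hu; rw [h0 u hu]; simp
  have i3 : ∀ j, Integrable (fun u => Q.Nc j u * h u) (μH[(n:ℝ)]) := by
    intro j
    refine integrable_aux hK hKO ((hNc j).mul hC1.continuous.continuousOn) ?_
    intro u hu; rw [h0 u hu]; simp
  have ibp : ∀ j, ∫ u, Q.Nc j u * fderiv ℝ h u (EuclideanSpace.single j 1) ∂(μH[(n:ℝ)])
      = - ∫ u, fderiv ℝ (Q.Nc j) u (EuclideanSpace.single j 1) * h u ∂(μH[(n:ℝ)]) := by
    intro j
    refine integral_mul_fderiv_eq_neg_fderiv_mul_of_integrable (i2 j) (i1 j) (i3 j) ?_ ?_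
    · intro u hu
      have huO := hKO (htK hu)
      exact (((Q.Nc_contDiffOn j) u huO).contDiffAt (Q.O_open.mem_nhds huO)).differentiableAt (by simp)
    · intro u _
      exact hC1.differentiable (by simp) u
  rw [s1, s2, s3, s4, s5, s6, integral_neg, integral_finset_sum _ (fun j _ => i1 j)]
  simp_rw [ibp]
  rw [Finset.sum_neg_distrib, neg_neg, ← integral_finset_sum _ (fun j _ => i2 j)]
  apply integral_eq_zero_of_ae
  refine Filter.Eventually.of_forall fun u => ?_
  show ∑ j, fderiv ℝ (Q.Nc j) u (EuclideanSpace.single j 1) * h u = 0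
  rw [← Finset.sum_mul]
  by_cases hu : u ∈ Q.O
  · rw [Q.div_zero' he hmin hu, zero_mul]
  · rw [h0 u (fun hh => hu (hKO hh)), mul_zero]

theorem finite_nhds (he : ‖e‖ = 1) {x} (hx : x ∈ M.carrier ∩ Q.W) :
    ∃ t ∈ nhds x, surfMeasure M t < ⊤ := by
  have hu := Q.P_mem x hx
  obtain ⟨t, ht, htb⟩ := Q.local_bounds he hu 2 (by norm_num)
  have h1 : ∃ s ∈ nhds (Q.P x), MeasurableSet s ∧ s ⊆ Q.O ∧ Q.ρ s < ⊤ := by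
    obtain ⟨T, hdet, t, ht, htO, hb, h1, h2⟩ := Q.approx he hu 2 (by norm_num)
    obtain ⟨r, hr, hrt⟩ := Metric.mem_nhds_iff.1 ht
    refine ⟨Metric.ball (Q.P x) r, Metric.ball_mem_nhds _ hr, measurableSet_ball, hrt.trans htO, ?_⟩
    rw [Q.ρ_apply measurableSet_ball (hrt.trans htO)]
    refine lt_of_le_of_lt (hausdorff_le_of_dist Q.Γ T _ 2
      (fun x hx y hy => h1 x (hrt hx) y (hrt hy)) n) ?_
    rw [Measure.addHaar_image_linearMap]
    refine ENNReal.mul_lt_top (by simp) (ENNReal.mul_lt_top ENNReal.ofReal_lt_top measure_ball_lt_top)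
  obtain ⟨s, hs, hsm, hsO, hfin⟩ := h1
  refine ⟨Q.W ∩ Q.P ⁻¹' s, Filter.inter_mem (Q.W_open.mem_nhds hx.2)
    (Q.P.continuous.continuousAt hs), ?_⟩
  rw [surfMeasure, Measure.restrict_apply (Q.W_open.measurableSet.inter (Q.P.continuous.measurable hsm))]
  rw [ρ, Measure.map_apply Q.P.continuous.measurable hsm,
    Measure.restrict_apply (Q.P.continuous.measurable hsm)] at hfin
  convert hfin using 2
  ext y; simp; tauto

theorem tangential (he : ‖e‖ = 1) {x} (hx : x ∈ M.carrier ∩ Q.W) (h : Eu n → ℝ)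
    (hd : DifferentiableAt ℝ h x) (h0 : ∀ᶠ y in nhds x, y ∈ M.carrier → h y = 0) (w : Eu n) :
    fderiv ℝ h x (w - ⟪M.nu x, w⟫ • M.nu x) = 0 := by
  have hu := Q.P_mem x hx
  have hΓ := Q.Γ_P x hx
  have hpos := Q.pos x hx
  have key : ∀ v, fderiv ℝ h x (fderiv ℝ Q.Γ (Q.P x) v) = 0 := by
    intro v
    have hd' := hd
    rw [← hΓ] at hd'
    have h1 : HasFDerivAt (fun u => h (Q.Γ u))
        ((fderiv ℝ h (Q.Γ (Q.P x))).comp (fderiv ℝ Q.Γ (Q.P x))) (Q.P x) :=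
      hd'.hasFDerivAt.comp _ (Q.diffAt hu).hasFDerivAt
    have h2 : HasFDerivAt (fun u => h (Q.Γ u)) (0 : _ →L[ℝ] ℝ) (Q.P x) := by
      refine (hasFDerivAt_const (0:ℝ) _).congr_of_eventuallyEq ?_
      have hc := Q.contAt hu
      rw [ContinuousAt, hΓ] at hc
      filter_upwards [Q.O_open.mem_nhds hu, hc.eventually h0] with y hy hy2
      exact hy2 (Q.Γ_mem y hy).1
    have h3 := congrArg (fun T => T v) (h1.unique h2)
    rw [hΓ] at h3
    simpa using h3
  obtain ⟨z, hz⟩ : ∃ z, z = w - ⟪M.nu x, w⟫ • M.nu x := ⟨_, rfl⟩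
  rw [← hz]
  have hz0 : ⟪M.nu x, z⟫ = 0 := by
    rw [hz, inner_sub_right, inner_smul_right, real_inner_self_eq_norm_sq, M.unit_nu x hx.1]; ring
  have h4 := key (Q.P z)
  rw [Q.fderiv_Γ hu, hΓ, Q.ι_P, inner_sub_right, inner_smul_right, hz0] at h4
  have : z - ⟪e, z⟫ • e - ((0 - ⟪e, z⟫ * ⟪M.nu x, e⟫) / ⟪M.nu x, e⟫) • e = z := by
    match_scalars
    · ring
    · field_simp
      ring
  rwa [this] at h4
end Patch

section EE

theorem meas_carrier (M : Hypersurface n) : MeasurableSet M.carrier := by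
  choose! U hUo hxU f hf hfe h1 h2 using M.locally_level_set
  obtain ⟨t, hts, htc, hcov⟩ := TopologicalSpace.countable_cover_nhdsWithin (s := M.carrier) (f := U)
    (fun x hx => mem_nhdsWithin_of_mem_nhds ((hUo x hx).mem_nhds (hxU x hx)))
  have : M.carrier = ⋃ x ∈ t, (M.carrier ∩ U x) := by
    rw [← Set.inter_iUnion₂]; exact (Set.inter_eq_left.2 hcov).symm
  rw [this]
  refine MeasurableSet.biUnion htc fun x hx => ?_
  rw [hfe x (hts hx)]
  exact (hUo x (hts hx)).measurableSet.inter
    ((hf x (hts hx)).continuous.measurable (measurableSet_singleton (0:ℝ)))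

variable {M : Hypersurface n}

theorem patch_nu {p : Eu n} (hp : p ∈ M.carrier) : ∃ Q : Patch M (M.nu p), p ∈ Q.W :=
  exists_patch M _ (M.unit_nu p hp) p hp
    (by rw [real_inner_self_eq_norm_sq, M.unit_nu p hp]; norm_num)

theorem finite_nhds' {p : Eu n} (hp : p ∈ M.carrier) : ∃ t ∈ nhds p, surfMeasure M t < ⊤ := by
  obtain ⟨Q, hQ⟩ := patch_nu hp
  exact Q.finite_nhds (M.unit_nu p hp) ⟨hp, hQ⟩

theorem tangential' {p : Eu n} (hp : p ∈ M.carrier) (h : Eu n → ℝ)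
    (hd : DifferentiableAt ℝ h p) (h0 : ∀ᶠ y in nhds p, y ∈ M.carrier → h y = 0) (w : Eu n) :
    fderiv ℝ h p (w - ⟪M.nu p, w⟫ • M.nu p) = 0 := by
  obtain ⟨Q, hQ⟩ := patch_nu hp
  exact Q.tangential (M.unit_nu p hp) ⟨hp, hQ⟩ h hd h0 w

theorem finite_compact {K : Set (Eu n)} (hK : IsCompact K) (hKM : K ⊆ M.carrier) :
    surfMeasure M K < ⊤ := by
  refine hK.measure_lt_top_of_nhdsWithin fun x hx => ?_
  obtain ⟨t, ht, h⟩ := finite_nhds' (hKM hx)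
  exact ⟨t, mem_nhdsWithin_of_mem_nhds ht, h⟩

theorem ae_mem (M : Hypersurface n) : ∀ᵐ x ∂surfMeasure M, x ∈ M.carrier :=
  ae_restrict_mem (meas_carrier M)

theorem integrable_of_cont {h : Eu n → ℝ} (hc : Continuous h) {K : Set (Eu n)}
    (hK : IsCompact K) (hKM : K ⊆ M.carrier) (h0 : ∀ x ∈ M.carrier, x ∉ K → h x = 0) :
    Integrable h (surfMeasure M) := by
  have h1 : IntegrableOn h K (surfMeasure M) :=
    hc.continuousOn.integrableOn_of_subset_isCompact hK hK.measurableSet subset_rfl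
      (finite_compact hK hKM).ne
  refine ((integrable_indicator_iff hK.measurableSet).2 h1).congr ?_
  filter_upwards [ae_mem M] with x hx
  by_cases hxK : x ∈ K
  · rw [Set.indicator_of_mem hxK]
  · rw [Set.indicator_of_notMem hxK, h0 x hx hxK]

theorem cont_tproj (M : Hypersurface n) (e : Eu n) :
    Continuous fun x => e - ⟪M.nu x, e⟫ • M.nu x := by
  have hnuc : Continuous M.nu := M.smooth_nu.continuous
  have h2 : Continuous fun x => ⟪M.nu x, e⟫ • M.nu x :=
    Continuous.smul (hnuc.inner (𝕜 := ℝ) (continuous_const (y := e))) hnuc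
  exact continuous_const.sub h2

theorem zero_off {ψ : Eu n → ℝ} (hψ : ContDiff ℝ 1 ψ) {K : Set (Eu n)}
    (hK : IsCompact K) (h0 : ∀ x ∈ M.carrier, x ∉ K → ψ x = 0)
    (e x : Eu n) (hx : x ∈ M.carrier) (hxK : x ∉ K) :
    fderiv ℝ ψ x (e - ⟪M.nu x, e⟫ • M.nu x) = 0 := by
  refine tangential' hx ψ (hψ.differentiable (by simp) x) ?_ e
  filter_upwards [hK.isClosed.isOpen_compl.mem_nhds hxK] with y hy hyM
  exact h0 y hyM hy

theorem integrable_dir {ψ : Eu n → ℝ} (hψ : ContDiff ℝ 1 ψ) {K : Set (Eu n)}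
    (hK : IsCompact K) (hKM : K ⊆ M.carrier) (h0 : ∀ x ∈ M.carrier, x ∉ K → ψ x = 0) (e : Eu n) :
    Integrable (fun x => fderiv ℝ ψ x (e - ⟪M.nu x, e⟫ • M.nu x)) (surfMeasure M) := by
  refine integrable_of_cont ?_ hK hKM (zero_off hψ hK h0 e)
  exact (hψ.continuous_fderiv (by simp)).clm_apply (cont_tproj M e)

theorem tderiv_eq' (i : Fin (n+1)) (φ : Eu n → ℝ) (x : Eu n) :
    tderiv M.nu i φ x = fderiv ℝ φ x (EuclideanSpace.single i 1
      - ⟪M.nu x, EuclideanSpace.single i 1⟫ • M.nu x) := by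
  rw [tderiv_eq, inner_single_r]

theorem local_div' (hmin : ∀ x ∈ M.carrier, meanCurv M x = 0) {p : Eu n} (hp : p ∈ M.carrier) :
    ∃ W : Set (Eu n), IsOpen W ∧ p ∈ W ∧ Bornology.IsBounded W ∧ ∀ ψ : Eu n → ℝ, ContDiff ℝ 1 ψ →
      HasCompactSupport ψ → tsupport ψ ⊆ W → ∀ i, ∫ x, tderiv M.nu i ψ x ∂surfMeasure M = 0 := by
  have hν := M.unit_nu p hp
  obtain ⟨Q, hQ⟩ := patch_nu hp
  have hpos : ∀ i : Fin (n+1), 0 < ⟪M.nu p, EuclideanSpace.single i (1:ℝ) + (2:ℝ) • M.nu p⟫ := by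
    intro i
    have h1 := abs_real_inner_le_norm (M.nu p) (EuclideanSpace.single i (1:ℝ))
    rw [hν, EuclideanSpace.norm_single] at h1
    have h2 := (abs_le.1 h1).1
    rw [inner_add_right, inner_smul_right, real_inner_self_eq_norm_sq, hν]
    norm_num at h2 ⊢
    linarith
  have hne : ∀ i : Fin (n+1), 0 < ‖EuclideanSpace.single i (1:ℝ) + (2:ℝ) • M.nu p‖ := by
    intro i
    rw [norm_pos_iff]
    intro h
    have := hpos i
    rw [h, inner_zero_right] at this
    exact lt_irrefl _ this
  let e : Fin (n+1) → Eu n := fun i =>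
    ‖EuclideanSpace.single i (1:ℝ) + (2:ℝ) • M.nu p‖⁻¹ • (EuclideanSpace.single i (1:ℝ) + (2:ℝ) • M.nu p)
  have he : ∀ i, ‖e i‖ = 1 := by
    intro i
    simp only [e]
    rw [norm_smul, norm_inv, norm_norm, inv_mul_cancel₀ (hne i).ne']
  have hQi : ∀ i, ∃ Q : Patch M (e i), p ∈ Q.W := by
    intro i
    refine exists_patch M _ (he i) p hp ?_
    simp only [e]
    rw [inner_smul_right]
    exact mul_pos (inv_pos.2 (hne i)) (hpos i)
  choose R hR using hQi
  refine ⟨(Q.W ∩ ⋂ i, (R i).W) ∩ Metric.ball p 1, ?_, ?_, ?_, ?_⟩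
  · exact (Q.W_open.inter (isOpen_iInter_of_finite fun i => (R i).W_open)).inter Metric.isOpen_ball
  · exact ⟨⟨hQ, Set.mem_iInter.2 hR⟩, Metric.mem_ball_self one_pos⟩
  · exact Metric.isBounded_ball.subset Set.inter_subset_right
  intro ψ hψ hcs hsub i
  have hsQ : tsupport ψ ⊆ Q.W := fun x hx => (hsub hx).1.1
  have hsR : tsupport ψ ⊆ (R i).W := fun x hx => Set.mem_iInter.1 (hsub hx).1.2 i
  obtain ⟨C, hC, hCW⟩ := Q.closedW
  have hK : IsCompact (tsupport ψ ∩ C) := hcs.isCompact.inter_right hC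
  have hKM : tsupport ψ ∩ C ⊆ M.carrier := by
    intro x hx
    have : x ∈ C ∩ Q.W := ⟨hx.2, hsQ hx.1⟩
    rw [← hCW] at this; exact this.1
  have h0 : ∀ x ∈ M.carrier, x ∉ tsupport ψ ∩ C → ψ x = 0 := by
    intro x hx hxK
    by_contra hne
    have ht : x ∈ tsupport ψ := subset_tsupport _ hne
    have : x ∈ M.carrier ∩ Q.W := ⟨hx, hsQ ht⟩
    rw [hCW] at this
    exact hxK ⟨ht, this.1⟩
  have a1 := Q.local_div hν hmin ψ hψ hcs hsQ
  have a2 := (R i).local_div (he i) hmin ψ hψ hcs hsR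
  have i1 := integrable_dir hψ hK hKM h0 (M.nu p)
  have i2 := integrable_dir hψ hK hKM h0 (e i)
  have hE : (EuclideanSpace.single i (1:ℝ) : Eu n)
      = ‖EuclideanSpace.single i (1:ℝ) + (2:ℝ) • M.nu p‖ • e i - (2:ℝ) • M.nu p := by
    simp only [e]
    rw [smul_smul, mul_inv_cancel₀ (hne i).ne', one_smul]; abel
  have : ∀ x, tderiv M.nu i ψ x = ‖EuclideanSpace.single i (1:ℝ) + (2:ℝ) • M.nu p‖ *
      fderiv ℝ ψ x (e i - ⟪M.nu x, e i⟫ • M.nu x)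
      - 2 * fderiv ℝ ψ x (M.nu p - ⟪M.nu x, M.nu p⟫ • M.nu x) := by
    intro x
    rw [tderiv_eq']
    generalize ‖EuclideanSpace.single i (1:ℝ) + (2:ℝ) • M.nu p‖ = c at hE ⊢
    generalize e i = ei at hE ⊢
    rw [hE, inner_sub_right, inner_smul_right, inner_smul_right]
    simp only [map_sub, map_smul, smul_eq_mul]
    ring
  simp_rw [this]
  rw [integral_sub (i2.const_mul _) (i1.const_mul _), integral_const_mul, integral_const_mul, a1, a2]
  simp

theorem global_div (hmin : ∀ x ∈ M.carrier, meanCurv M x = 0) {ψ : Eu n → ℝ} (hψ : ContDiff ℝ 1 ψ)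
    {K : Set (Eu n)} (hK : IsCompact K) (hKM : K ⊆ M.carrier)
    (h0 : ∀ x ∈ M.carrier, x ∉ K → ψ x = 0) (i : Fin (n+1)) :
    ∫ x, tderiv M.nu i ψ x ∂surfMeasure M = 0 := by
  classical
  have hloc : ∀ p : K, _ := fun p => local_div' hmin (hKM p.2)
  choose W hWo hpW hWb hW using hloc
  obtain ⟨t, ht⟩ := hK.elim_finite_subcover W hWo
    (fun x hx => Set.mem_iUnion.2 ⟨⟨x, hx⟩, hpW ⟨x, hx⟩⟩)
  obtain ⟨χ, hχ⟩ := SmoothPartitionOfUnity.exists_isSubordinate (modelWithCornersSelf ℝ (Eu n))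
    hK.isClosed (fun k : t => W k) (fun k => hWo k) (by
      intro x hx
      have := ht hx
      simp only [Set.mem_iUnion] at this ⊢
      obtain ⟨k, hk, hxk⟩ := this
      exact ⟨⟨k, hk⟩, hxk⟩)
  have hχs : ∀ k, ContDiff ℝ 1 (χ k) := fun k =>
    ((χ k).contMDiff.contDiff).of_le (by exact_mod_cast le_top)
  have hp : ∀ k, ContDiff ℝ 1 (fun x => χ k x * ψ x) := fun k => (hχs k).mul hψ
  have hp0 : ∀ k, ∀ x ∈ M.carrier, x ∉ K → χ k x * ψ x = 0 := fun k x hx hxK => by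
    rw [h0 x hx hxK, mul_zero]
  have hts : ∀ k, tsupport (fun x => χ k x * ψ x) ⊆ tsupport (χ k) := fun k =>
    tsupport_mul_subset_left
  have hcs : ∀ k, HasCompactSupport (fun x => χ k x * ψ x) := by
    intro k
    refine (Metric.isCompact_of_isClosed_isBounded (isClosed_tsupport _) ?_)
    exact (hWb k).subset ((hts k).trans (hχ k))
  have hz : ∀ k, ∫ x, tderiv M.nu i (fun x => χ k x * ψ x) x ∂surfMeasure M = 0 := fun k =>
    hW k _ (hp k) (hcs k) ((hts k).trans (hχ k)) i
  have hae : ∀ᵐ x ∂surfMeasure M, tderiv M.nu i ψ x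
      = ∑ k, tderiv M.nu i (fun x => χ k x * ψ x) x := by
    filter_upwards [ae_mem M] with x hx
    have hdiff : ∀ k ∈ Finset.univ, DifferentiableAt ℝ (fun x => χ k x * ψ x) x := fun k _ =>
      (hp k).differentiable (by simp) x
    have h2 := tangential' hx (fun y => ψ y - ∑ k, χ k y * ψ y)
      ((hψ.differentiable (by simp) x).sub (DifferentiableAt.fun_sum hdiff)) (by
        refine Filter.Eventually.of_forall fun y hy => ?_
        by_cases hyK : y ∈ K
        · have := χ.sum_eq_one hyK
          rw [finsum_eq_sum_of_fintype] at this
          rw [← Finset.sum_mul, this, one_mul, sub_self]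
        · simp [h0 y hy hyK]) (EuclideanSpace.single i 1)
    rw [fderiv_fun_sub (hψ.differentiable (by simp) x) (DifferentiableAt.fun_sum hdiff),
      fderiv_fun_sum hdiff] at h2
    simp only [tderiv_eq']
    rw [ContinuousLinearMap.sub_apply, ContinuousLinearMap.sum_apply, sub_eq_zero] at h2
    exact h2
  rw [integral_congr_ae hae, integral_finset_sum]
  · simp [hz]
  · intro k _
    exact (integrable_dir (hp k) hK hKM (hp0 k) (EuclideanSpace.single i 1)).congr
      (Filter.Eventually.of_forall fun x => (tderiv_eq' i _ x).symm)

end EE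


theorem fderiv_tproj (ν φ) (x w : Eu n) :
    fderiv ℝ φ x (w - ⟪ν x, w⟫ • ν x) = ⟪tgrad ν φ x, w⟫ := by
  have h : ∀ v, fderiv ℝ φ x v = ⟪gradient φ x, v⟫ := by
    intro v
    rw [gradient, InnerProductSpace.toDual_symm_apply]
  rw [h, tgrad, inner_sub_left, inner_sub_right, inner_smul_right, real_inner_smul_left]
  ring

theorem cont_tgrad (M : Hypersurface n) {φ : Eu n → ℝ} (hφ : ContDiff ℝ 1 φ) :
    Continuous (tgrad M.nu φ) := by
  have hnuc : Continuous M.nu := M.smooth_nu.continuous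
  have h1 : Continuous (gradient φ) :=
    (InnerProductSpace.toDual ℝ (Eu n)).symm.continuous.comp (hφ.continuous_fderiv (by simp))
  have h2 : Continuous fun x => ⟪gradient φ x, M.nu x⟫ • M.nu x :=
    Continuous.smul (h1.inner (𝕜 := ℝ) hnuc) hnuc
  exact h1.sub h2

/-- the regularised radial field times the square of the test function -/
def psi (φ : Eu n → ℝ) (ε : ℝ) (i : Fin (n+1)) (x : Eu n) : ℝ :=
  φ x ^ 2 * (x i * (‖x‖ ^ 2 + ε)⁻¹)

theorem psi_contDiff {φ : Eu n → ℝ} (hφ : ContDiff ℝ 1 φ) {ε : ℝ} (hε : 0 < ε) (i : Fin (n+1)) :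
    ContDiff ℝ 1 (psi φ ε i) := by
  have h1 : ContDiff ℝ 1 fun x : Eu n => x i :=
    (EuclideanSpace.proj (𝕜 := ℝ) i : Eu n →L[ℝ] ℝ).contDiff
  have h2 : ContDiff ℝ 1 fun x : Eu n => (‖x‖ ^ 2 + ε)⁻¹ := by
    refine ContDiff.inv ((contDiff_norm_sq ℝ).add contDiff_const) fun x => ?_
    positivity
  exact (hφ.pow 2).mul (h1.mul h2)

theorem psi_fderiv {φ : Eu n → ℝ} (hφ : ContDiff ℝ 1 φ) {ε : ℝ} (hε : 0 < ε) (i : Fin (n+1))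
    (x w : Eu n) : fderiv ℝ (psi φ ε i) x w =
      2 * φ x * (‖x‖ ^ 2 + ε)⁻¹ * (x i * fderiv ℝ φ x w)
       + φ x ^ 2 * ((‖x‖ ^ 2 + ε)⁻¹ * w i - 2 * (‖x‖ ^ 2 + ε)⁻¹ ^ 2 * (x i * ⟪x, w⟫)) := by
  have hq : ‖x‖ ^ 2 + ε ≠ 0 := by positivity
  have h1 : HasFDerivAt (fun x : Eu n => x i) (EuclideanSpace.proj (𝕜 := ℝ) i : Eu n →L[ℝ] ℝ) x :=
    (EuclideanSpace.proj (𝕜 := ℝ) i : Eu n →L[ℝ] ℝ).hasFDerivAt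
  have h2 : HasFDerivAt (fun x : Eu n => ‖x‖ ^ 2 + ε) (2 • innerSL ℝ x) x :=
    ((hasStrictFDerivAt_norm_sq x).hasFDerivAt).add_const ε
  have h3 := (hasDerivAt_inv hq).comp_hasFDerivAt x h2
  have h4 := ((hφ.differentiable (by simp) x).hasFDerivAt).pow 2
  have h5 := h4.mul (h1.mul h3)
  have h6 : HasFDerivAt (psi φ ε i) _ x := h5
  rw [h6.fderiv]
  simp
  field_simp
  ring

theorem sum_tproj (N x : Eu n) : ∑ i, x i • (EuclideanSpace.single i (1:ℝ) - N i • N)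
    = x - ⟪N, x⟫ • N := by
  simp_rw [smul_sub, smul_smul]
  rw [Finset.sum_sub_distrib, ← vec_eq_sum, ← Finset.sum_smul, inner_eq_sum]
  simp_rw [mul_comm]

theorem sum_psi {M : Hypersurface n} {φ : Eu n → ℝ} (hφ : ContDiff ℝ 1 φ) {ε : ℝ} (hε : 0 < ε)
    {x : Eu n} (hx : x ∈ M.carrier) : ∑ i, tderiv M.nu i (psi φ ε i) x =
      2 * φ x * (‖x‖ ^ 2 + ε)⁻¹ * ⟪tgrad M.nu φ x, x⟫
       + φ x ^ 2 * ((‖x‖ ^ 2 + ε)⁻¹ * n - 2 * (‖x‖ ^ 2 + ε)⁻¹ ^ 2 * (‖x‖ ^ 2 - ⟪M.nu x, x⟫ ^ 2)) := by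
  simp_rw [tderiv_eq, psi_fderiv hφ hε]
  rw [Finset.sum_add_distrib, ← Finset.mul_sum, ← Finset.mul_sum, Finset.sum_sub_distrib,
    ← Finset.mul_sum, ← Finset.mul_sum]
  have a1 : ∑ i, x i * fderiv ℝ φ x (EuclideanSpace.single i (1:ℝ) - M.nu x i • M.nu x)
      = ⟪tgrad M.nu φ x, x⟫ := by
    rw [← fderiv_tproj, ← sum_tproj, map_sum]
    simp only [map_smul, smul_eq_mul]
  have a2 : ∑ i, x i * ⟪x, EuclideanSpace.single i (1:ℝ) - M.nu x i • M.nu x⟫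
      = ‖x‖ ^ 2 - ⟪M.nu x, x⟫ ^ 2 := by
    have := congrArg (fun z => ⟪x, z⟫) (sum_tproj (M.nu x) x)
    simp only [inner_sum, inner_smul_right x] at this
    rw [this, inner_sub_right, inner_smul_right, real_inner_self_eq_norm_sq, real_inner_comm x]
    ring
  have a3 : ∑ i, (EuclideanSpace.single i (1:ℝ) - M.nu x i • M.nu x) i = n := by
    have h1 : ∀ i, (EuclideanSpace.single i (1:ℝ) - M.nu x i • M.nu x) i = 1 - M.nu x i * M.nu x i := by
      intro i; simp
    simp_rw [h1]
    rw [Finset.sum_sub_distrib, ← inner_eq_sum, real_inner_self_eq_norm_sq, M.unit_nu x hx]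
    simp
  rw [a1, a2, a3]

theorem pointwise_ineq {a f g q s t k G : ℝ} (ha : 0 < a) (hq : 0 < q) (hs : s ≤ q) 
    (hg : g ^ 2 ≤ G ^ 2 * q) (hk : 0 ≤ k) :
    a ^ 2 / 4 * (f ^ 2 / q) ≤ G ^ 2 + a / 2 * (2 * f * q⁻¹ * g
      + f ^ 2 * (q⁻¹ * (a + 2) - 2 * q⁻¹ ^ 2 * (s - k))) := by
  obtain ⟨r, hr⟩ : ∃ r, r = q⁻¹ := ⟨_, rfl⟩
  have hr0 : 0 < r := hr ▸ inv_pos.2 hq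
  have hrq : r * q = 1 := by rw [hr]; exact inv_mul_cancel₀ hq.ne'
  rw [div_eq_mul_inv (f ^ 2), ← hr]
  have h1 : r ^ 2 * (s - k) ≤ r := by
    have : r ^ 2 * (s - k) ≤ r ^ 2 * q := by gcongr; linarith
    nlinarith
  have h2 : r * g ^ 2 ≤ G ^ 2 := by
    calc r * g ^ 2 ≤ r * (G ^ 2 * q) := by gcongr
      _ = G ^ 2 * (r * q) := by ring
      _ = G ^ 2 := by rw [hrq, mul_one]
  have h3 : 0 ≤ r * (a / 2 * f + g) ^ 2 := by positivity
  have h4 : 0 ≤ a * f ^ 2 * (r - r ^ 2 * (s - k)) :=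
    mul_nonneg (by positivity) (by linarith)
  nlinarith

theorem reg_ineq (M : Hypersurface n) (hn : 3 ≤ n)
    (hmin : ∀ x ∈ M.carrier, meanCurv M x = 0) (φ : Eu n → ℝ)
    (hφ : C1cOn M.carrier φ) {ε : ℝ} (hε : 0 < ε) :
    ((n : ℝ) - 2) ^ 2 / 4 * ∫ x, φ x ^ 2 / (‖x‖ ^ 2 + ε) ∂surfMeasure M
      ≤ ∫ x, ‖tgrad M.nu φ x‖ ^ 2 ∂surfMeasure M := by
  obtain ⟨hφ, K, hK, hKM, h0⟩ := hφ
  have ha : (0:ℝ) < (n:ℝ) - 2 := by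
    have : (3:ℝ) ≤ n := by exact_mod_cast hn
    linarith
  have hq : ∀ x : Eu n, 0 < ‖x‖ ^ 2 + ε := fun x => by positivity
  have p0 : ∀ i, ∀ x ∈ M.carrier, x ∉ K → psi φ ε i x = 0 := by
    intro i x hx hxK
    simp [psi, h0 x hx hxK]
  have I1 : Integrable (fun x => φ x ^ 2 / (‖x‖ ^ 2 + ε)) (surfMeasure M) := by
    refine integrable_of_cont ?_ hK hKM ?_
    · exact (hφ.continuous.pow 2).div ((continuous_norm.pow 2).add continuous_const)
        fun x => (hq x).ne'
    · intro x hx hxK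
      simp [h0 x hx hxK]
  have I2 : Integrable (fun x => ‖tgrad M.nu φ x‖ ^ 2) (surfMeasure M) := by
    refine integrable_of_cont ((cont_tgrad M hφ).norm.pow 2) hK hKM ?_
    intro x hx hxK
    have : tgrad M.nu φ x = 0 := by
      have := zero_off hφ hK h0 (tgrad M.nu φ x) x hx hxK
      rw [fderiv_tproj] at this
      exact inner_self_eq_zero.1 this
    simp [this]
  have I3 : ∀ i, Integrable (fun x => tderiv M.nu i (psi φ ε i) x) (surfMeasure M) := by
    intro i
    exact (integrable_dir (psi_contDiff hφ hε i) hK hKM (p0 i) (EuclideanSpace.single i 1)).congr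
      (Filter.Eventually.of_forall fun x => (tderiv_eq' i _ x).symm)
  have I4 : Integrable (fun x => ∑ i, tderiv M.nu i (psi φ ε i) x) (surfMeasure M) :=
    integrable_finset_sum _ fun i _ => I3 i
  have Z : ∫ x, ∑ i, tderiv M.nu i (psi φ ε i) x ∂surfMeasure M = 0 := by
    rw [integral_finset_sum _ fun i _ => I3 i]
    exact Finset.sum_eq_zero fun i _ => global_div hmin (psi_contDiff hφ hε i) hK hKM (p0 i) i
  have hle : ∫ x, ((n : ℝ) - 2) ^ 2 / 4 * (φ x ^ 2 / (‖x‖ ^ 2 + ε)) ∂surfMeasure M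
      ≤ ∫ x, (‖tgrad M.nu φ x‖ ^ 2 + ((n:ℝ) - 2) / 2 * ∑ i, tderiv M.nu i (psi φ ε i) x)
        ∂surfMeasure M := by
    refine integral_mono_ae (I1.const_mul _) (I2.add (I4.const_mul _)) ?_
    filter_upwards [ae_mem M] with x hx
    rw [sum_psi hφ hε hx]
    have hg : ⟪tgrad M.nu φ x, x⟫ ^ 2 ≤ ‖tgrad M.nu φ x‖ ^ 2 * (‖x‖ ^ 2 + ε) := by
      have h1 := abs_real_inner_le_norm (tgrad M.nu φ x) x
      have h2 := pow_le_pow_left₀ (abs_nonneg _) h1 2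
      rw [sq_abs, mul_pow] at h2
      nlinarith [sq_nonneg ‖tgrad M.nu φ x‖]
    have := pointwise_ineq (t := 0) (f := φ x) ha (hq x) (s := ‖x‖ ^ 2) (by linarith) hg (sq_nonneg ⟪M.nu x, x⟫)
    rwa [sub_add_cancel] at this
  rw [integral_const_mul, integral_add I2 (I4.const_mul _), integral_const_mul, Z, mul_zero,
    add_zero] at hle
  exact hle

/-- Carron's Hardy inequality with the sharp Euclidean constant on minimal
hypersurfaces, `n ≥ 3`. -/
theorem carron_minimal (M : Hypersurface n) (hn : 3 ≤ n)
    (hmin : ∀ x ∈ M.carrier, meanCurv M x = 0) (φ : Eu n → ℝ)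
    (hφ : C1cOn M.carrier φ) :
    ((n : ℝ) - 2) ^ 2 / 4 * ∫ x, φ x ^ 2 / ‖x‖ ^ 2 ∂surfMeasure M
      ≤ ∫ x, ‖tgrad M.nu φ x‖ ^ 2 ∂surfMeasure M := by
  by_cases hint : Integrable (fun x => φ x ^ 2 / ‖x‖ ^ 2) (surfMeasure M)
  swap
  · rw [integral_undef hint, mul_zero]
    exact integral_nonneg fun x => by positivity
  have hne : ∀ᵐ x ∂surfMeasure M, x ≠ 0 := by
    have hna : NoAtoms (μH[(n:ℝ)] : Measure (Eu n)) :=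
      Measure.noAtoms_hausdorff _ (by exact_mod_cast (by omega : 0 < n))
    refine ae_restrict_of_ae ?_
    rw [ae_iff]
    simp only [ne_eq, not_not, Set.setOf_eq_eq_singleton]
    exact hna.measure_singleton 0
  have hlim : Filter.Tendsto (fun k : ℕ => ∫ x, φ x ^ 2 / (‖x‖ ^ 2 + 1 / ((k:ℝ) + 1)) ∂surfMeasure M)
      Filter.atTop (nhds (∫ x, φ x ^ 2 / ‖x‖ ^ 2 ∂surfMeasure M)) := by
    refine tendsto_integral_of_dominated_convergence (fun x => φ x ^ 2 / ‖x‖ ^ 2) ?_ hint ?_ ?_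
    · intro k
      refine Continuous.aestronglyMeasurable ?_
      exact (hφ.1.continuous.pow 2).div ((continuous_norm.pow 2).add continuous_const)
        fun x => by positivity
    · intro k
      filter_upwards [hne] with x hx
      have := norm_pos_iff.2 hx
      rw [Real.norm_of_nonneg (by positivity)]
      gcongr
      have : (0:ℝ) < 1 / ((k:ℝ) + 1) := by positivity
      linarith
    · filter_upwards [hne] with x hx
      have := norm_pos_iff.2 hx
      have h1 : Filter.Tendsto (fun k : ℕ => ‖x‖ ^ 2 + 1 / ((k:ℝ) + 1)) Filter.atTop
          (nhds (‖x‖ ^ 2 + 0)) := tendsto_const_nhds.add tendsto_one_div_add_atTop_nhds_zero_nat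
      rw [add_zero] at h1
      exact tendsto_const_nhds.div h1 (by positivity)
  refine le_of_tendsto (hlim.const_mul _) (Filter.Eventually.of_forall fun k => ?_)
  exact reg_ineq M hn hmin φ hφ (by positivity)
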